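/- Let Γ be the free product (ℤ/2ℤ × ℤ/2ℤ) * (ℤ/2ℤ), with R0 and R2 the images of (1,0) and (0,1) from the first free factor and R1 the image of the generator of the second free factor. Set S1 = R1, S2 = R2·R1·R2 and S = R0·R1·R2·R0. Then S1 and S2 have order 2, S has infinite order, the canonical homomorphism from the free product (ℤ/2ℤ) * (ℤ/2ℤ) * ℤ to Γ sending the generators of the first two factors to S1 and S2 and the generator 1 of ℤ to S is injective, and its image (the subgroup of Γ generated by S1, S2, S) has index 4 in Γ. -/

import Mathlib

/-- `Γ` is the free product `(ℤ/2ℤ × ℤ/2ℤ) ∗ (ℤ/2ℤ)` underlying the algebraic theory of maps. -/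
abbrev Γ : Type := Monoid.Coprod (Multiplicative (ZMod 2 × ZMod 2)) (Multiplicative (ZMod 2))

/-- `R0` is the image of `(1,0)` from the first free factor. -/
def R0 : Γ := Monoid.Coprod.inl (Multiplicative.ofAdd ((1, 0) : ZMod 2 × ZMod 2))

/-- `R1` is the image of the generator of the second free factor. -/
def R1 : Γ := Monoid.Coprod.inr (Multiplicative.ofAdd (1 : ZMod 2))

/-- `R2` is the image of `(0,1)` from the first free factor. -/
def R2 : Γ := Monoid.Coprod.inl (Multiplicative.ofAdd ((0, 1) : ZMod 2 × ZMod 2))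

open Multiplicative (ofAdd)

/-- The Klein four-group, the first free factor of `Γ`. -/
abbrev Klein : Type := Multiplicative (ZMod 2 × ZMod 2)

lemma Klein.cases (v : Klein) :
    v = 1 ∨ v = ofAdd (1, 0) ∨ v = ofAdd (0, 1) ∨ v = ofAdd (1, 1) := by
  revert v; decide

lemma eq_one_or_eq_ofAdd_one (z : Multiplicative (ZMod 2)) : z = 1 ∨ z = ofAdd 1 := by
  revert z; decide

lemma ofAdd_one_mul_ofAdd_one : ofAdd (1 : ZMod 2) * ofAdd (1 : ZMod 2) = 1 := by decide

lemma R1_mul_R1 : R1 * R1 = 1 := by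
  rw [R1, ← map_mul, ofAdd_one_mul_ofAdd_one, map_one]

lemma R0_mul_R0 : R0 * R0 = 1 := by
  rw [R0, ← map_mul, show ofAdd ((1, 0) : ZMod 2 × ZMod 2) * ofAdd (1, 0) = 1 by decide, map_one]

lemma R2_mul_R2 : R2 * R2 = 1 := by
  rw [R2, ← map_mul, show ofAdd ((0, 1) : ZMod 2 × ZMod 2) * ofAdd (0, 1) = 1 by decide, map_one]

lemma R0_mul_R2 : R0 * R2 = Monoid.Coprod.inl (ofAdd (1, 1)) := by
  rw [R0, R2, ← map_mul]; rfl

lemma commute_R0_R2 : Commute R0 R2 := (Commute.all _ _).map Monoid.Coprod.inl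

lemma S2_mul_S2 : (R2 * R1 * R2) * (R2 * R1 * R2) = 1 := by
  calc _ = R2 * R1 * (R2 * R2) * R1 * R2 := by group
    _ = R2 * (R1 * R1) * R2 := by rw [R2_mul_R2]; group
    _ = 1 := by rw [R1_mul_R1, mul_one, R2_mul_R2]

/-- The homomorphism from `ℤ/2ℤ` determined by an element of square one. -/
def involutionHom {G : Type*} [Group G] (g : G) (hg : g * g = 1) :
    Multiplicative (ZMod 2) →* G where
  toFun z := if z = 1 then 1 else g
  map_one' := if_pos rfl
  map_mul' x y := by
    have h1 : ofAdd (1 : ZMod 2) ≠ 1 := by decide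
    rcases eq_one_or_eq_ofAdd_one x with rfl | rfl <;>
      rcases eq_one_or_eq_ofAdd_one y with rfl | rfl <;>
      simp [h1, ofAdd_one_mul_ofAdd_one, hg]

lemma involutionHom_ofAdd_one {G : Type*} [Group G] (g : G) (hg : g * g = 1) :
    involutionHom g hg (ofAdd 1) = g := by
  have h1 : ofAdd (1 : ZMod 2) ≠ 1 := by decide
  simp [involutionHom, h1]

/-- The permutation of the four cosets of `N(4)` induced by `R1`. -/
def cosetFlip (v : Klein) : Klein :=
  if v.toAdd.1 = 0 then v else v * ofAdd (0, 1)

lemma cosetFlip_cosetFlip : ∀ v, cosetFlip (cosetFlip v) = v := by decide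

lemma cosetFlip_one : cosetFlip 1 = 1 := by decide

lemma cosetFlip_zero_one : cosetFlip (ofAdd (0, 1)) = ofAdd (0, 1) := by decide

lemma cosetFlip_one_one : cosetFlip (ofAdd (1, 1)) = ofAdd (1, 0) := by decide

lemma cosetFlip_one_zero : cosetFlip (ofAdd (1, 0)) = ofAdd (1, 1) := by decide

/-- The translation action of the Klein four-group on the second factor. -/
def translationHom (K : Type*) : Klein →* Equiv.Perm (K × Klein) where
  toFun v := (Equiv.refl K).prodCongr (Equiv.mulLeft v)
  map_one' := by ext1 ⟨k, w⟩; simp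
  map_mul' u v := by ext1 ⟨k, w⟩; simp [mul_assoc]

lemma translationHom_apply {K : Type*} (v : Klein) (k : K) (w : Klein) :
    translationHom K v (k, w) = (k, v * w) := rfl

section Schreier

variable {K : Type*} [Group K] (a b s : K)

/-- The Schreier cocycle of `R1` on the four cosets of `N(4)`. -/
def schreierCocycle (v : Klein) : K :=
  if v = 1 then a else if v = ofAdd (0, 1) then b else if v = ofAdd (1, 1) then s else s⁻¹

lemma schreierCocycle_one : schreierCocycle a b s 1 = a := if_pos rfl

lemma schreierCocycle_zero_one : schreierCocycle a b s (ofAdd (0, 1)) = b := by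
  rw [schreierCocycle, if_neg (by decide), if_pos rfl]

lemma schreierCocycle_one_one : schreierCocycle a b s (ofAdd (1, 1)) = s := by
  rw [schreierCocycle, if_neg (by decide), if_neg (by decide), if_pos rfl]

lemma schreierCocycle_one_zero : schreierCocycle a b s (ofAdd (1, 0)) = s⁻¹ := by
  rw [schreierCocycle, if_neg (by decide), if_neg (by decide), if_neg (by decide)]

variable {a b}

lemma schreierCocycle_cosetFlip_mul (ha : a * a = 1) (hb : b * b = 1) (v : Klein) :
    schreierCocycle a b s (cosetFlip v) * schreierCocycle a b s v = 1 := by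
  rcases v.cases with rfl | rfl | rfl | rfl
  · rw [cosetFlip_one, schreierCocycle_one, ha]
  · rw [cosetFlip_one_zero, schreierCocycle_one_one, schreierCocycle_one_zero, mul_inv_cancel]
  · rw [cosetFlip_zero_one, schreierCocycle_zero_one, hb]
  · rw [cosetFlip_one_one, schreierCocycle_one_one, schreierCocycle_one_zero, inv_mul_cancel]

/-- The permutation of `K × Klein` by which `R1` acts. -/
def flipPerm (ha : a * a = 1) (hb : b * b = 1) : Equiv.Perm (K × Klein) :=
  Function.Involutive.toPerm
    (fun x => (schreierCocycle a b s x.2 * x.1, cosetFlip x.2)) fun x => by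
      simp only [← mul_assoc, schreierCocycle_cosetFlip_mul s ha hb, cosetFlip_cosetFlip, one_mul]

lemma flipPerm_apply (ha : a * a = 1) (hb : b * b = 1) (k : K) (v : Klein) :
    flipPerm s ha hb (k, v) = (schreierCocycle a b s v * k, cosetFlip v) := rfl

lemma flipPerm_mul_flipPerm (ha : a * a = 1) (hb : b * b = 1) :
    flipPerm s ha hb * flipPerm s ha hb = 1 :=
  Equiv.ext (Function.Involutive.toPerm_involutive _)

/-- The action of `Γ` on `K × Klein` induced by the Schreier cocycle. -/
def monomialAction (ha : a * a = 1) (hb : b * b = 1) : Γ →* Equiv.Perm (K × Klein) :=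
  Monoid.Coprod.lift (translationHom K) (involutionHom _ (flipPerm_mul_flipPerm s ha hb))

lemma monomialAction_inl (ha : a * a = 1) (hb : b * b = 1) (v : Klein) :
    monomialAction s ha hb (Monoid.Coprod.inl v) = translationHom K v := rfl

lemma monomialAction_R1 (ha : a * a = 1) (hb : b * b = 1) :
    monomialAction s ha hb R1 = flipPerm s ha hb :=
  involutionHom_ofAdd_one _ (flipPerm_mul_flipPerm s ha hb)

variable {s} {φ : K →* Γ}

lemma monomialAction_hom (ha : a * a = 1) (hb : b * b = 1)
    (htop : Subgroup.closure {a, b, s} = ⊤) (hφa : φ a = R1) (hφb : φ b = R2 * R1 * R2)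
    (hφs : φ s = R0 * R1 * R2 * R0) (k l : K) :
    monomialAction s ha hb (φ k) (l, 1) = (k * l, 1) := by
  have hk : k ∈ Subgroup.closure {a, b, s} := by rw [htop]; trivial
  induction hk using Subgroup.closure_induction generalizing l with
  | mem x hx =>
    rcases hx with rfl | rfl | rfl
    · rw [hφa, monomialAction_R1, flipPerm_apply, schreierCocycle_one, cosetFlip_one]
    · rw [hφb, map_mul, map_mul, monomialAction_R1, R2, monomialAction_inl]
      simp only [Equiv.Perm.mul_apply, translationHom_apply, flipPerm_apply, mul_one,
        schreierCocycle_zero_one, cosetFlip_zero_one]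
      exact congrArg _ (by decide)
    · rw [hφs, map_mul, map_mul, map_mul, monomialAction_R1, R0, R2, monomialAction_inl,
        monomialAction_inl]
      simp only [Equiv.Perm.mul_apply, translationHom_apply, flipPerm_apply, mul_one]
      rw [show ofAdd ((0, 1) : ZMod 2 × ZMod 2) * ofAdd (1, 0) = ofAdd (1, 1) from rfl,
        schreierCocycle_one_one, cosetFlip_one_one]
      exact congrArg _ (by decide)
  | one => simp
  | mul x y _ _ hx hy => rw [map_mul, map_mul, Equiv.Perm.mul_apply, hy, hx, mul_assoc]
  | inv x _ hx =>
    rw [map_inv, map_inv, Equiv.Perm.inv_eq_iff_eq, hx, mul_inv_cancel_left]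

theorem hom_injective (ha : a * a = 1) (hb : b * b = 1)
    (htop : Subgroup.closure {a, b, s} = ⊤) (hφa : φ a = R1) (hφb : φ b = R2 * R1 * R2)
    (hφs : φ s = R0 * R1 * R2 * R0) : Function.Injective φ := fun k l h => by
  have := monomialAction_hom ha hb htop hφa hφb hφs k 1
  rw [h, monomialAction_hom ha hb htop hφa hφb hφs] at this
  simpa using (congrArg Prod.fst this).symm

variable (φ) in
/-- The Schreier decomposition `(k, v) ↦ v · φ(k)` of elements of `Γ`. -/
def schreierProd (x : K × Klein) : Γ := Monoid.Coprod.inl x.2 * φ x.1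

lemma schreierProd_flipPerm (ha : a * a = 1) (hb : b * b = 1)
    (hφa : φ a = R1) (hφb : φ b = R2 * R1 * R2) (hφs : φ s = R0 * R1 * R2 * R0) (x : K × Klein) :
    schreierProd φ (flipPerm s ha hb x) = R1 * schreierProd φ x := by
  obtain ⟨k, v⟩ := x
  have h0 : R0⁻¹ = R0 := inv_eq_of_mul_eq_one_left R0_mul_R0
  have h1 : R1⁻¹ = R1 := inv_eq_of_mul_eq_one_left R1_mul_R1
  have h2 : R2⁻¹ = R2 := inv_eq_of_mul_eq_one_left R2_mul_R2
  rw [flipPerm_apply, schreierProd, schreierProd, map_mul, ← mul_assoc, ← mul_assoc]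
  congr 1
  rcases v.cases with rfl | rfl | rfl | rfl
  · simp only [schreierCocycle_one, cosetFlip_one, hφa, map_one, one_mul, mul_one]
  · simp only [schreierCocycle_one_zero, cosetFlip_one_zero, map_inv, hφs, ← R0_mul_R2]
    change R0 * R2 * _ = R1 * R0
    rw [commute_R0_R2.eq]
    simp only [mul_inv_rev, h0, h1, h2]
    calc _ = R2 * (R0 * R0) * R2 * R1 * R0 := by group
      _ = _ := by rw [R0_mul_R0, mul_one, R2_mul_R2, one_mul]
  · simp only [schreierCocycle_zero_one, cosetFlip_zero_one, hφb]
    change R2 * _ = R1 * R2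
    calc _ = (R2 * R2) * R1 * R2 := by group
      _ = _ := by rw [R2_mul_R2, one_mul]
  · simp only [schreierCocycle_one_one, cosetFlip_one_one, hφs, ← R0_mul_R2]
    change R0 * _ = _
    rw [commute_R0_R2.eq]
    calc _ = (R0 * R0) * R1 * R2 * R0 := by group
      _ = _ := by rw [R0_mul_R0, one_mul, mul_assoc]

lemma schreierProd_monomialAction (ha : a * a = 1) (hb : b * b = 1)
    (hφa : φ a = R1) (hφb : φ b = R2 * R1 * R2) (hφs : φ s = R0 * R1 * R2 * R0)
    (g : Γ) (x : K × Klein) :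
    schreierProd φ (monomialAction s ha hb g x) = g * schreierProd φ x := by
  induction g using Monoid.Coprod.induction_on generalizing x with
  | inl v =>
    obtain ⟨k, w⟩ := x
    rw [monomialAction_inl, translationHom_apply, schreierProd, schreierProd, map_mul, mul_assoc]
  | inr z =>
    rcases eq_one_or_eq_ofAdd_one z with rfl | rfl
    · simp
    · change schreierProd φ (monomialAction s ha hb R1 x) = R1 * _
      rw [monomialAction_R1, schreierProd_flipPerm ha hb hφa hφb hφs]
  | mul g h hg hh => rw [map_mul, Equiv.Perm.mul_apply, hg, hh, mul_assoc]

theorem hom_range_index (ha : a * a = 1) (hb : b * b = 1)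
    (htop : Subgroup.closure {a, b, s} = ⊤) (hφa : φ a = R1) (hφb : φ b = R2 * R1 * R2)
    (hφs : φ s = R0 * R1 * R2 * R0) : φ.range.index = 4 := by
  have hbij : Function.Bijective
      (fun v : Klein => (QuotientGroup.mk (Monoid.Coprod.inl v : Γ) : Γ ⧸ φ.range)) := by
    refine ⟨fun v w h => ?_, fun q => ?_⟩
    · obtain ⟨k, hk⟩ := QuotientGroup.eq.mp h
      have h1 := monomialAction_hom ha hb htop hφa hφb hφs k 1
      rw [hk, ← map_inv, ← map_mul, monomialAction_inl, translationHom_apply] at h1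
      simpa [inv_mul_eq_one] using congrArg Prod.snd h1
    · obtain ⟨g, rfl⟩ := QuotientGroup.mk_surjective q
      have hg := schreierProd_monomialAction ha hb hφa hφb hφs g (1, 1)
      simp only [schreierProd, map_one, mul_one] at hg
      exact ⟨_, QuotientGroup.eq.mpr ⟨_, eq_inv_mul_of_mul_eq hg⟩⟩
  rw [Subgroup.index, ← Nat.card_eq_of_bijective _ hbij, Nat.card_eq_fintype_card]
  decide

theorem hom_range (htop : Subgroup.closure {a, b, s} = ⊤) (hφa : φ a = R1)
    (hφb : φ b = R2 * R1 * R2) (hφs : φ s = R0 * R1 * R2 * R0) :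
    φ.range = Subgroup.closure {R1, R2 * R1 * R2, R0 * R1 * R2 * R0} := by
  rw [MonoidHom.range_eq_map, ← htop, MonoidHom.map_closure, Set.image_insert_eq,
    Set.image_pair, hφa, hφb, hφs]

end Schreier

/-- The free product `(ℤ/2ℤ) ∗ (ℤ/2ℤ) ∗ ℤ`. -/
abbrev FreeProd : Type :=
  Monoid.Coprod (Monoid.Coprod (Multiplicative (ZMod 2)) (Multiplicative (ZMod 2)))
    (Multiplicative ℤ)

namespace FreeProd

/-- The generator of the first factor. -/
def a : FreeProd := Monoid.Coprod.inl (Monoid.Coprod.inl (ofAdd 1))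

/-- The generator of the second factor. -/
def b : FreeProd := Monoid.Coprod.inl (Monoid.Coprod.inr (ofAdd 1))

/-- The generator of the infinite cyclic factor. -/
def s : FreeProd := Monoid.Coprod.inr (ofAdd 1)

lemma a_mul_a : a * a = 1 := by
  rw [a, ← map_mul, ← map_mul, ofAdd_one_mul_ofAdd_one, map_one, map_one]

lemma b_mul_b : b * b = 1 := by
  rw [b, ← map_mul, ← map_mul, ofAdd_one_mul_ofAdd_one, map_one, map_one]

lemma closure_eq_top : Subgroup.closure {a, b, s} = ⊤ := by
  refine eq_top_iff.mpr fun k _ => ?_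
  induction k using Monoid.Coprod.induction_on with
  | inl w =>
    induction w using Monoid.Coprod.induction_on with
    | inl z =>
      rcases eq_one_or_eq_ofAdd_one z with rfl | rfl
      · rw [map_one, map_one]
        exact one_mem (Subgroup.closure {a, b, s})
      · exact Subgroup.subset_closure (.inl rfl)
    | inr z =>
      rcases eq_one_or_eq_ofAdd_one z with rfl | rfl
      · rw [map_one, map_one]
        exact one_mem (Subgroup.closure {a, b, s})
      · exact Subgroup.subset_closure (.inr (.inl rfl))
    | mul x y hx hy =>
      rw [map_mul]
      exact mul_mem (hx trivial) (hy trivial)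
  | inr z =>
    have hz : z = ofAdd 1 ^ z.toAdd := by simp [← ofAdd_zsmul]
    rw [hz]
    have h := zpow_mem (Subgroup.subset_closure (k := {a, b, s}) (.inr (.inr rfl))) z.toAdd
    exact (map_zpow (Monoid.Coprod.inr : Multiplicative ℤ →* FreeProd) (ofAdd 1) z.toAdd) ▸ h
  | mul x y hx hy => exact mul_mem (hx trivial) (hy trivial)

end FreeProd

/-- The canonical homomorphism onto `N(4)`. -/
def parentHom : FreeProd →* Γ :=
  Monoid.Coprod.lift
    (Monoid.Coprod.lift (involutionHom R1 R1_mul_R1) (involutionHom (R2 * R1 * R2) S2_mul_S2))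
    (zpowersHom Γ (R0 * R1 * R2 * R0))

lemma parentHom_a : parentHom FreeProd.a = R1 := involutionHom_ofAdd_one R1 R1_mul_R1

lemma parentHom_b : parentHom FreeProd.b = R2 * R1 * R2 := involutionHom_ofAdd_one _ S2_mul_S2

lemma parentHom_s : parentHom FreeProd.s = R0 * R1 * R2 * R0 :=
  zpow_one (R0 * R1 * R2 * R0)

lemma parentHom_injective : Function.Injective parentHom :=
  hom_injective (K := FreeProd) FreeProd.a_mul_a FreeProd.b_mul_b FreeProd.closure_eq_top
    parentHom_a parentHom_b parentHom_s

/-- With `S1 = R1`, `S2 = R2·R1·R2` and `S = R0·R1·R2·R0`, the elements `S1` and `S2` have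
order 2, `S` has infinite order, the canonical homomorphism
`(ℤ/2ℤ) ∗ (ℤ/2ℤ) ∗ ℤ → Γ` sending the generators of the first two factors to `S1` and `S2`
and the generator `1` of `ℤ` to `S` is injective, and its image, the subgroup generated by
`S1, S2, S`, has index 4 in `Γ`.  (This is the parent group `N(4)` of Graver–Watkins.) -/
theorem stmt_4 :
    orderOf R1 = 2 ∧ orderOf (R2 * R1 * R2) = 2 ∧ ¬ IsOfFinOrder (R0 * R1 * R2 * R0) ∧
    (∃ φ : Monoid.Coprod
        (Monoid.Coprod (Multiplicative (ZMod 2)) (Multiplicative (ZMod 2)))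
        (Multiplicative ℤ) →* Γ,
      φ (Monoid.Coprod.inl (Monoid.Coprod.inl (Multiplicative.ofAdd (1 : ZMod 2)))) = R1 ∧
      φ (Monoid.Coprod.inl (Monoid.Coprod.inr (Multiplicative.ofAdd (1 : ZMod 2)))) = R2 * R1 * R2 ∧
      φ (Monoid.Coprod.inr (Multiplicative.ofAdd (1 : ℤ))) = R0 * R1 * R2 * R0 ∧
      Function.Injective φ ∧
      MonoidHom.range
        (G := Monoid.Coprod
          (Monoid.Coprod (Multiplicative (ZMod 2)) (Multiplicative (ZMod 2)))
          (Multiplicative ℤ)) φ =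
        Subgroup.closure {R1, R2 * R1 * R2, R0 * R1 * R2 * R0}) ∧
    (Subgroup.closure {R1, R2 * R1 * R2, R0 * R1 * R2 * R0} : Subgroup Γ).index = 4 := by
  have h2 : orderOf (Multiplicative.ofAdd (1 : ZMod 2)) = 2 :=
    orderOf_eq_prime (by decide) (by decide)
  have hrange := hom_range (K := FreeProd) FreeProd.closure_eq_top
    parentHom_a parentHom_b parentHom_s
  refine ⟨?_, ?_, fun hfin => ?_, ⟨parentHom, parentHom_a, parentHom_b, parentHom_s,
    parentHom_injective, hrange⟩, ?_⟩
  · rw [R1, orderOf_injective _ Monoid.Coprod.inr_injective, h2]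
  · rw [← parentHom_b]
    refine (orderOf_injective (G := FreeProd) parentHom parentHom_injective _).trans ?_
    refine (orderOf_injective _ Monoid.Coprod.inl_injective _).trans ?_
    rw [orderOf_injective _ Monoid.Coprod.inr_injective, h2]
  · rw [← parentHom_s] at hfin
    have hs := (Function.Injective.isOfFinOrder_iff (f := Monoid.Coprod.inr) Monoid.Coprod.inr_injective).mp
      ((Function.Injective.isOfFinOrder_iff (G := FreeProd) parentHom_injective).mp hfin)
    exact not_isOfFinAddOrder_of_isAddTorsionFree one_ne_zero
      (isOfFinOrder_ofAdd_iff.mp hs)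
  · rw [← hrange]
    exact hom_range_index (K := FreeProd) FreeProd.a_mul_a FreeProd.b_mul_b
      FreeProd.closure_eq_top parentHom_a parentHom_b parentHom_s
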